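/- arXiv:math/0506354 — 4 statements merged into one kernel-verified Lean document; each statement's English description precedes it below -/
import Mathlib

section
/- For every ℓ ∈ {1,…,n} one has Σ_{a=1}^L w_ℓ^(a) = 0, and for every q ∈ {1,…,k} one has Σ_{a=1}^L p_q^(a) = 0; that is, the sum of the entries of each x-row and of each s-row of 𝖫^{−1} vanishes. (Equivalently, writing Δ·𝖫^{−1} in integer form with rows (A_ℓ^a), (B_q^a) as in (2.6): Σ_{a∈I} A_ℓ^a = 0 and Σ_{a∈I} B_q^a = 0 for each fixed ℓ and q.) [Proposition 2.1, part 2), equation (2.7)] -/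
open Matrix Finset

/-- Index of the monomial rows `a^{ν-1}+q`, `1 ≤ q ≤ τ_ν` (the set `I_Λ`). -/
abbrev MonIdx (k : ℕ) (τ : Fin k → ℕ) := Σ ν : Fin k, Fin (τ ν)

/-- Row index of the Cayley matrix `𝖫`: the monomial rows together with, for every
`ν`, the three rows `a^ν-2`, `a^ν-1`, `a^ν` (encoded as `(ν,0)`, `(ν,1)`, `(ν,2)`). -/
abbrev RowIdx (k : ℕ) (τ : Fin k → ℕ) := MonIdx k τ ⊕ (Fin k × Fin 3)

/-- Column (variable) index: `n` x-coordinates, `2k` y-coordinates (the y-coordinates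
`2ν-1`, `2ν` are encoded as `(ν,0)`, `(ν,1)`), and `k` s-coordinates. -/
abbrev ColIdx (k n : ℕ) := Fin n ⊕ ((Fin k × Fin 2) ⊕ Fin k)

/-- The exponent matrix `𝖫` of the Cayley polynomial `F(x,s,y)`. -/
noncomputable def cayley (k n : ℕ) (τ : Fin k → ℕ) (v : (ν : Fin k) → Fin (τ ν) → Fin n → ℤ)
    (I : Fin k → Finset (Fin n)) : Matrix (RowIdx k τ) (ColIdx k n) ℂ :=
  fun r c =>
    match r, c with
    | Sum.inl ⟨ν, q⟩, Sum.inl j => (v ν q j : ℂ)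
    | Sum.inl ⟨ν, _⟩, Sum.inr (Sum.inl (μ, t)) => if μ = ν ∧ t = 0 then 1 else 0
    | Sum.inl _, Sum.inr (Sum.inr _) => 0
    | Sum.inr (ν, r), Sum.inl j => if r = 1 ∧ j ∈ I ν then 1 else 0
    | Sum.inr (ν, r), Sum.inr (Sum.inl (μ, t)) =>
        if μ = ν ∧ ((r = 0 ∧ t = 0) ∨ (r ≠ 0 ∧ t = 1)) then 1 else 0
    | Sum.inr (ν, r), Sum.inr (Sum.inr q) => if r = 0 ∧ q = ν then 1 else 0

/-- The linear functions `ξ_a(z) = Σ_j w_j^(a) + Σ_r q_r^(a) + Σ_q p_q^(a) z_q`,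
read off from the columns of `𝖫⁻¹`. -/
noncomputable def xiFun {k n : ℕ} {τ : Fin k → ℕ} (Linv : Matrix (ColIdx k n) (RowIdx k τ) ℂ)
    (z : Fin k → ℂ) (a : RowIdx k τ) : ℂ :=
  (∑ j : Fin n, Linv (Sum.inl j) a) + (∑ r : Fin k × Fin 2, Linv (Sum.inr (Sum.inl r)) a)
    + ∑ q : Fin k, Linv (Sum.inr (Sum.inr q)) a * z q

/-- Every row of the Cayley matrix has exactly one `y`-entry equal to `1`, so the sum of its
`y`-columns is the all-ones vector. -/
theorem cayley_mulVec_yIndicator (k n : ℕ) (τ : Fin k → ℕ)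
    (v : (ν : Fin k) → Fin (τ ν) → Fin n → ℤ) (I : Fin k → Finset (Fin n)) :
    cayley k n τ v I *ᵥ (Sum.elim 0 (Sum.elim 1 0) : ColIdx k n → ℂ) = 1 := by
  have hcard (ν : Fin k) (t : Fin 2) :
      #{x : Fin k × Fin 2 | x.1 = ν ∧ x.2 = t} = 1 :=
    Finset.card_eq_one.mpr ⟨(ν, t), by ext x; simp [Prod.ext_iff]⟩
  funext r
  rcases r with ⟨ν, q⟩ | ⟨ν, r⟩
  · simp [Matrix.mulVec, dotProduct, cayley, hcard]
  · fin_cases r <;> simp [Matrix.mulVec, dotProduct, cayley, hcard]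

/-- Proposition 2.1, part 2), equation (2.7). -/
theorem row_sums_vanish
    (k n : ℕ) (hk : 1 ≤ k) (τ : Fin k → ℕ) (hτ : ∀ ν, 1 ≤ τ ν)
    (hn : n = ∑ ν : Fin k, τ ν)
    (v : (ν : Fin k) → Fin (τ ν) → Fin n → ℤ)
    (I : Fin k → Finset (Fin n))
    (hdisj : ∀ ν μ : Fin k, ν ≠ μ → Disjoint (I ν) (I μ))
    (hcover : ∀ j : Fin n, ∃ ν : Fin k, j ∈ I ν)
    (Linv : Matrix (ColIdx k n) (RowIdx k τ) ℂ)
    (hL₁ : cayley k n τ v I * Linv = 1)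
    (hL₂ : Linv * cayley k n τ v I = 1)
    :
    (∀ j : Fin n, ∑ a : RowIdx k τ, Linv (Sum.inl j) a = 0) ∧
    (∀ q : Fin k, ∑ a : RowIdx k τ, Linv (Sum.inr (Sum.inr q)) a = 0) := by
  have h : Linv *ᵥ 1 = (Sum.elim 0 (Sum.elim 1 0) : ColIdx k n → ℂ) := by
    rw [← cayley_mulVec_yIndicator k n τ v I, Matrix.mulVec_mulVec, hL₂, Matrix.one_mulVec]
  have hrow (c : ColIdx k n) :
      ∑ a : RowIdx k τ, Linv c a = (Sum.elim 0 (Sum.elim 1 0) : ColIdx k n → ℂ) c := by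
    rw [← h]
    simp only [Matrix.mulVec, dotProduct_one]
  exact ⟨fun j => hrow (Sum.inl j), fun q => hrow (Sum.inr (Sum.inr q))⟩
end

section
/- Let Δ be a positive integer such that Δ·𝖫^{−1} has integer entries, and set B_q^a = Δ·p_q^(a) ∈ ℤ. Then for every q ∈ {1,…,k}: Σ_{a : B_q^a > 0} B_q^a = − Σ_{a : B_q^a < 0} B_q^a. (This is the statement that the two operators P_{q,i}(θ_s, ζ) and Q_{q,i}(θ_s, ζ) of the Horn-type hypergeometric system (2.9) annihilating the period integral have equal degree.) [Corollary 2.2, equation (2.10)] -/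
open Matrix Finset

theorem card_filter_fst_snd_eq {α β : Type*} [Fintype α] [Fintype β] [DecidableEq α]
    [DecidableEq β] (a : α) (b : β) :
    #{x : α × β | x.1 = a ∧ x.2 = b} = 1 :=
  Finset.card_eq_one.2 ⟨(a, b), by ext; simp [Prod.ext_iff]⟩

/-- Every row of the Cayley matrix has exactly one `1` among its `y`-coordinates, so it maps
the indicator vector of the `y`-coordinates to the all-ones vector. -/
theorem cayley_mulVec_indicator_y (k n : ℕ) (τ : Fin k → ℕ)
    (v : (ν : Fin k) → Fin (τ ν) → Fin n → ℤ) (I : Fin k → Finset (Fin n)) :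
    cayley k n τ v I *ᵥ Sum.elim 0 (Sum.elim 1 0) = 1 := by
  ext r
  rcases r with ⟨ν, q⟩ | ⟨ν, r⟩
  · simp [Matrix.mulVec, dotProduct, cayley, card_filter_fst_snd_eq]
  · fin_cases r <;> simp [Matrix.mulVec, dotProduct, cayley, card_filter_fst_snd_eq]

/-- The `s`-rows of a left inverse of the Cayley matrix have zero sum. -/
theorem sum_s_row_eq_zero {k n : ℕ} {τ : Fin k → ℕ}
    {v : (ν : Fin k) → Fin (τ ν) → Fin n → ℤ} {I : Fin k → Finset (Fin n)}
    {Linv : Matrix (ColIdx k n) (RowIdx k τ) ℂ} (hL : Linv * cayley k n τ v I = 1)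
    (q : Fin k) : ∑ a, Linv (Sum.inr (Sum.inr q)) a = 0 := by
  have h : Linv *ᵥ 1 = (Sum.elim 0 (Sum.elim 1 0) : ColIdx k n → ℂ) := by
    rw [← cayley_mulVec_indicator_y k n τ v I, Matrix.mulVec_mulVec, hL, Matrix.one_mulVec]
  simpa [Matrix.mulVec, dotProduct] using congrFun h (Sum.inr (Sum.inr q))

/-- If an integer-valued function has zero sum, its positive and negative parts balance. -/
theorem sum_pos_eq_neg_sum_neg {α : Type*} (s : Finset α) (f : α → ℤ)
    (h : ∑ a ∈ s, f a = 0) :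
    ∑ a ∈ s with 0 < f a, f a = -∑ a ∈ s with f a < 0, f a := by
  rw [eq_neg_iff_add_eq_zero, ← h, Finset.sum_filter, Finset.sum_filter,
    ← Finset.sum_add_distrib]
  refine Finset.sum_congr rfl fun a _ => ?_
  split_ifs <;> omega

/-- Corollary 2.2, equation (2.10): Σ_{a : B_q^a > 0} B_q^a = − Σ_{a : B_q^a < 0} B_q^a. -/
theorem horn_operators_equal_degree
    (k n : ℕ) (hk : 1 ≤ k) (τ : Fin k → ℕ) (hτ : ∀ ν, 1 ≤ τ ν)
    (hn : n = ∑ ν : Fin k, τ ν)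
    (v : (ν : Fin k) → Fin (τ ν) → Fin n → ℤ)
    (I : Fin k → Finset (Fin n))
    (hdisj : ∀ ν μ : Fin k, ν ≠ μ → Disjoint (I ν) (I μ))
    (hcover : ∀ j : Fin n, ∃ ν : Fin k, j ∈ I ν)
    (Linv : Matrix (ColIdx k n) (RowIdx k τ) ℂ)
    (hL₁ : cayley k n τ v I * Linv = 1)
    (hL₂ : Linv * cayley k n τ v I = 1)
    (Δ : ℕ) (hΔ : 0 < Δ)
    (hint : ∀ (c : ColIdx k n) (a : RowIdx k τ), ∃ m : ℤ, (Δ : ℂ) * Linv c a = (m : ℂ))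
    (B : Fin k → RowIdx k τ → ℤ)
    (hB : ∀ (q : Fin k) (a : RowIdx k τ),
      ((B q a : ℤ) : ℂ) = (Δ : ℂ) * Linv (Sum.inr (Sum.inr q)) a) :
    ∀ q : Fin k,
      ∑ a ∈ Finset.univ.filter (fun a : RowIdx k τ => 0 < B q a), B q a
        = - ∑ a ∈ Finset.univ.filter (fun a : RowIdx k τ => B q a < 0), B q a := by
  intro q
  refine sum_pos_eq_neg_sum_neg _ _ ?_
  have h : ((∑ a, B q a : ℤ) : ℂ) = 0 := by
    simp only [Int.cast_sum, hB, ← Finset.mul_sum, sum_s_row_eq_zero hL₂, mul_zero]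
  exact_mod_cast h
end

section
/- For all q, ν ∈ {1,…,k}: Σ_{i=1}^{τ_ν} p_q^{(a^{ν−1}+i)} = −δ_{qν}; i.e., the k×k matrix whose (ν, q) entry is the sum of the q-th s-entries of the columns of 𝖫^{−1} belonging to the ν-th monomial block {a^{ν−1}+1, …, a^{ν−1}+τ_ν} equals −Id_k. [the block-sum identity underlying equation (3.9)] -/
open Matrix Finset

/-- The block-sum identity underlying equation (3.9): Σ_{i=1}^{τ_ν} p_q^{(a^{ν−1}+i)} = −δ_{qν}. -/
theorem block_sums_of_p
    (k n : ℕ) (hk : 1 ≤ k) (τ : Fin k → ℕ) (hτ : ∀ ν, 1 ≤ τ ν)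
    (hn : n = ∑ ν : Fin k, τ ν)
    (v : (ν : Fin k) → Fin (τ ν) → Fin n → ℤ)
    (I : Fin k → Finset (Fin n))
    (hdisj : ∀ ν μ : Fin k, ν ≠ μ → Disjoint (I ν) (I μ))
    (hcover : ∀ j : Fin n, ∃ ν : Fin k, j ∈ I ν)
    (Linv : Matrix (ColIdx k n) (RowIdx k τ) ℂ)
    (hL₁ : cayley k n τ v I * Linv = 1)
    (hL₂ : Linv * cayley k n τ v I = 1)
    :
    ∀ q ν : Fin k,
      ∑ i : Fin (τ ν), Linv (Sum.inr (Sum.inr q)) (Sum.inl ⟨ν, i⟩)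
        = if q = ν then -1 else 0 := by
  intro q ν
  have hs : (Linv * cayley k n τ v I) (Sum.inr (Sum.inr q)) (Sum.inr (Sum.inr ν)) =
      if q = ν then 1 else 0 := by simp [hL₂, Matrix.one_apply]
  have hy : (Linv * cayley k n τ v I) (Sum.inr (Sum.inr q)) (Sum.inr (Sum.inl (ν, 0))) = 0 := by
    simp [hL₂]
  simp only [Matrix.mul_apply, Fintype.sum_sum_type, Fintype.sum_sigma, Fintype.sum_prod_type,
    cayley, Fin.sum_univ_three] at hs hy
  simp at hs hy
  rw [hs] at hy
  rw [eq_neg_of_add_eq_zero_left hy]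
  split_ifs <;> simp
end

section
/- For every q ∈ {1,…,k} and every z ∈ ℂ^k: Σ_{j=1}^k ⟨ᵀg^(q), (column j of ᵀV^Λ)⟩ · ξ^(j)(z) = 1 − z_{ν(q)}. In matrix form, writing ᵀQ̂ for the k×k matrix with (j,q) entry ⟨ᵀg^(q), column j of ᵀV^Λ⟩ (which in the intended application equals the transposed quasihomogeneous degree ᵀQ^(q)_{ν(j)}) and ν* for the permutation matrix of ν: ᵗ(ᵀQ̂)·ᵗ(ξ^(1)(z), …, ξ^(k)(z)) = ν*·ᵗ(1−z_1, …, 1−z_k). [equation (3.20), the key identity in the proof of Theorem 3.1] -/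
open Matrix Finset

/-- The n×n matrix `𝖫_Λ` whose rows (indexed by the monomial rows, i.e. in the order
`v^(1)_1, …, v^(1)_{τ_1}, …, v^(k)_{τ_k}`) are the exponent vectors. -/
noncomputable def lamMat (k n : ℕ) (τ : Fin k → ℕ)
    (v : (ν : Fin k) → Fin (τ ν) → Fin n → ℤ) : Matrix (MonIdx k τ) (Fin n) ℂ :=
  fun σ j => (v σ.1 σ.2 j : ℂ)

/-- The n×k matrix `V^Λ` whose q-th column is the indicator vector `v^(q)_{τ_q+1}` of `I^(q)`. -/
noncomputable def vLam (k n : ℕ) (I : Fin k → Finset (Fin n)) :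
    Matrix (Fin n) (Fin k) ℂ :=
  fun j q => if j ∈ I q then 1 else 0

/-- The vector `c(z)`: entry `1` at the x- and y-coordinates, `z q` at the q-th s-coordinate. -/
noncomputable def cayleyWeight (k n : ℕ) (z : Fin k → ℂ) : ColIdx k n → ℂ :=
  Sum.elim (fun _ => 1) (Sum.elim (fun _ => 1) z)

lemma xiFun_eq_vecMul {k n : ℕ} {τ : Fin k → ℕ}
    (Linv : Matrix (ColIdx k n) (RowIdx k τ) ℂ) (z : Fin k → ℂ) :
    xiFun Linv z = cayleyWeight k n z ᵥ* Linv := by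
  funext a
  simp [xiFun, cayleyWeight, Matrix.vecMul, dotProduct, Fintype.sum_sum_type, mul_comm, add_assoc]

lemma xiFun_vecMul_of_leftInverse {k n : ℕ} {τ : Fin k → ℕ}
    {Linv : Matrix (ColIdx k n) (RowIdx k τ) ℂ} {A : Matrix (RowIdx k τ) (ColIdx k n) ℂ}
    (hL : Linv * A = 1) (z : Fin k → ℂ) :
    xiFun Linv z ᵥ* A = cayleyWeight k n z := by
  rw [xiFun_eq_vecMul, Matrix.vecMul_vecMul, hL, Matrix.vecMul_one]

lemma vecMul_cayley_odd {k n : ℕ} {τ : Fin k → ℕ} (v : (ν : Fin k) → Fin (τ ν) → Fin n → ℤ)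
    (I : Fin k → Finset (Fin n)) (x : RowIdx k τ → ℂ) (μ : Fin k) :
    (x ᵥ* cayley k n τ v I) (Sum.inr (Sum.inl (μ, 0)))
      = ∑ t : Fin (τ μ), x (Sum.inl ⟨μ, t⟩) + x (Sum.inr (μ, 0)) := by
  simp only [Matrix.vecMul, dotProduct, Fintype.sum_sum_type, Fintype.sum_sigma,
    Fintype.sum_prod_type, cayley]
  simp [Fin.sum_univ_three]

lemma vecMul_cayley_s {k n : ℕ} {τ : Fin k → ℕ} (v : (ν : Fin k) → Fin (τ ν) → Fin n → ℤ)
    (I : Fin k → Finset (Fin n)) (x : RowIdx k τ → ℂ) (μ : Fin k) :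
    (x ᵥ* cayley k n τ v I) (Sum.inr (Sum.inr μ)) = x (Sum.inr (μ, 0)) := by
  simp only [Matrix.vecMul, dotProduct, Fintype.sum_sum_type, Fintype.sum_sigma,
    Fintype.sum_prod_type, cayley]
  simp [Fin.sum_univ_three]

/-- The sum of `ξ_a(z)` over the monomial rows of one block is `1 - z μ`. -/
lemma sum_xiFun_block {k n : ℕ} {τ : Fin k → ℕ} {v : (ν : Fin k) → Fin (τ ν) → Fin n → ℤ}
    {I : Fin k → Finset (Fin n)} {Linv : Matrix (ColIdx k n) (RowIdx k τ) ℂ}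
    (hL : Linv * cayley k n τ v I = 1) (z : Fin k → ℂ) (μ : Fin k) :
    ∑ t : Fin (τ μ), xiFun Linv z (Sum.inl ⟨μ, t⟩) = 1 - z μ := by
  have h := xiFun_vecMul_of_leftInverse hL z
  have hy := congrFun h (Sum.inr (Sum.inl (μ, 0)))
  have hs := congrFun h (Sum.inr (Sum.inr μ))
  rw [vecMul_cayley_odd] at hy
  rw [vecMul_cayley_s] at hs
  simp only [cayleyWeight, Sum.elim_inl, Sum.elim_inr] at hy hs
  rw [← hs, ← hy, add_sub_cancel_right]

/-- Equation (3.20): Σ_j ⟨ᵀg^(q), col_j ᵀV^Λ⟩·ξ^(j)(z) = 1 − z_{ν(q)}. -/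
theorem transposed_degrees_identity
    (k n : ℕ) (hk : 1 ≤ k) (τ : Fin k → ℕ) (hτ : ∀ ν, 1 ≤ τ ν)
    (hn : n = ∑ ν : Fin k, τ ν)
    (v : (ν : Fin k) → Fin (τ ν) → Fin n → ℤ)
    (I : Fin k → Finset (Fin n))
    (hdisj : ∀ ν μ : Fin k, ν ≠ μ → Disjoint (I ν) (I μ))
    (hcover : ∀ j : Fin n, ∃ ν : Fin k, j ∈ I ν)
    (Linv : Matrix (ColIdx k n) (RowIdx k τ) ℂ)
    (hL₁ : cayley k n τ v I * Linv = 1)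
    (hL₂ : Linv * cayley k n τ v I = 1)
    (M : Matrix (MonIdx k τ) (Fin n) ℂ)
    (hM₁ : (lamMat k n τ v)ᵀ * M = 1) (hM₂ : M * (lamMat k n τ v)ᵀ = 1)
    (νp : Equiv.Perm (Fin k))
    (Tg : Fin k → MonIdx k τ → ℝ)
    (hTg : ∀ (q : Fin k) (σ : MonIdx k τ),
      (σ.1 = νp q → Tg q σ ≠ 0) ∧ (σ.1 ≠ νp q → Tg q σ = 0))
    (TV : Matrix (MonIdx k τ) (Fin k) ℝ)
    (xi' : Fin k → (Fin k → ℂ) → ℂ)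
    (h310T : ∀ (z : Fin k → ℂ) (σ : MonIdx k τ),
      xiFun Linv z (Sum.inl σ)
        = ((Tg (νp.symm σ.1) σ : ℝ) : ℂ) * ∑ j : Fin k, ((TV σ j : ℝ) : ℂ) * xi' j z)
    :
    ∀ (q : Fin k) (z : Fin k → ℂ),
      ∑ j : Fin k, ((∑ σ : MonIdx k τ, Tg q σ * TV σ j : ℝ) : ℂ) * xi' j z
        = 1 - z (νp q) := by
  intro q z
  rw [← sum_xiFun_block hL₂ z (νp q)]
  push_cast
  simp_rw [Finset.sum_mul]
  rw [Finset.sum_comm, Fintype.sum_sigma, Finset.sum_eq_single (νp q)]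
  · refine Finset.sum_congr rfl fun t _ => ?_
    rw [h310T, Equiv.symm_apply_apply, Finset.mul_sum]
    simp only [mul_assoc]
  · intro μ _ hμ
    simp [(hTg q ⟨μ, _⟩).2 hμ]
  · simp
end
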